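/- For every non-negative integer q, all non-negative integers t and k, every q-colorful graph (H,ψ), and every q-colorful graph (G,χ) together with a set X ⊆ V(G) such that every component J of G−X has (J,χ) restricted and the treewidth of the torso of X in G is at most t, at least one of the following holds: (1) there is a set S ⊆ V(G) with |S| ≤ (t+1)(k−1) such that no component of (G−S,χ) contains (H,ψ) as a colorful minor; (2) q ≥ 1, |ψ(V(H))| ≤ q−1, and there is a set S ⊆ V(G) with |S| ≤ (t+1)(k−1) such that every component of (G−S,χ) is either restricted or does not contain (H,ψ) as a colorful minor; or (3) there is a packing of (H,ψ) of size k in (G,χ). -/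

import Mathlib

open SimpleGraph

/-- `(H, ψ)` is a colorful minor of `(G, χ)`. -/
def IsColorfulMinor {q : ℕ} {α β : Type*} (H : SimpleGraph α) (ψ : α → Finset (Fin q))
    (G : SimpleGraph β) (χ : β → Finset (Fin q)) : Prop :=
  ∃ B : α → Set β,
    (∀ v, (G.induce (B v)).Connected) ∧
    (Pairwise fun u v => Disjoint (B u) (B v)) ∧
    (∀ u v, H.Adj u v → ∃ x ∈ B u, ∃ y ∈ B v, G.Adj x y) ∧
    (∀ v, ∀ c ∈ ψ v, ∃ x ∈ B v, c ∈ χ x)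

/-- `C` is a connected component of `G − S`. -/
def IsComponentAvoiding {V : Type*} (G : SimpleGraph V) (S C : Set V) : Prop :=
  Disjoint C S ∧ (G.induce C).Connected ∧
    ∀ x ∈ C, ∀ y, y ∉ S → G.Adj x y → y ∈ C

/-- The torso of `X` in `G`. -/
def torso {V : Type*} (G : SimpleGraph V) (X : Set V) : SimpleGraph X :=
  SimpleGraph.fromRel fun a b =>
    ∃ p : G.Walk a.1 b.1, ∀ v ∈ p.support, v ∉ X ∨ v = a.1 ∨ v = b.1

/-- `(T, β)` is a tree-decomposition of `G`. -/
structure IsTreeDecomp {V ι : Type*} (G : SimpleGraph V) (T : SimpleGraph ι)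
    (β : ι → Set V) : Prop where
  isTree : T.IsTree
  covers_vertex : ∀ v : V, ∃ t : ι, v ∈ β t
  covers_edge : ∀ ⦃u v : V⦄, G.Adj u v → ∃ t : ι, u ∈ β t ∧ v ∈ β t
  bags_connected : ∀ v : V, (T.induce {t : ι | v ∈ β t}).Connected

/-- `G` has treewidth at most `w`. -/
def TreewidthAtMost {V : Type*} (G : SimpleGraph V) (w : ℕ) : Prop :=
  ∃ (m : ℕ) (T : SimpleGraph (Fin m)) (β : Fin m → Set V),
    IsTreeDecomp G T β ∧ ∀ t, (β t).ncard ≤ w + 1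

/-- the initial part of a path up to the top of a connected set -/
lemma top_path {ι : Type*} (T : SimpleGraph ι) (hT : T.IsTree) (r : ι) (A : Set ι)
    (hA : (T.induce A).Connected) (v : ι) (hv : v ∈ A)
    (hmin : ∀ w ∈ A, T.dist r v ≤ T.dist r w) (x : ι) (hx : x ∈ A)
    (p : T.Walk r x) (hp : p.IsPath) :
    p.getVert (T.dist r v) = v ∧
      ∀ i, T.dist r v ≤ i → p.getVert i ∈ A := by
  classical
  obtain ⟨p1, hp1, hl⟩ := hT.connected.exists_path_of_dist r v
  obtain ⟨w0⟩ := hA.preconnected ⟨v, hv⟩ ⟨x, hx⟩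
  let w1 := w0.toPath
  let p2 : T.Walk v x := w1.1.map (Embedding.induce (G := T) A).toHom
  have hp2 : p2.IsPath := Walk.map_isPath_of_injective (Embedding.induce (G := T) A).injective w1.2
  have hp2A : ∀ y ∈ p2.support, y ∈ A := by
    intro y hy
    have hy' : y ∈ w1.1.support.map (Embedding.induce (G := T) A).toHom := by
      rw [← Walk.support_map]; exact hy
    rw [List.mem_map] at hy'
    replace hy := hy'
    obtain ⟨z, _, rfl⟩ := hy
    exact z.2
  have hcat : (p1.append p2).IsPath := by
    rw [Walk.isPath_def, Walk.support_append]
    refine List.Nodup.append hp1.support_nodup (hp2.support_nodup.tail) ?_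
    intro y hy1 hy2
    have hyA : y ∈ A := hp2A y (List.mem_of_mem_tail hy2)
    have h1 := hmin y hyA
    have h2 : T.dist r y ≤ (p1.takeUntil y hy1).length := dist_le _
    have h3 : y = v := by
      by_contra hne
      have := Walk.length_takeUntil_lt hy1 hne
      omega
    subst h3
    have h4 := hp2.support_nodup
    rw [Walk.support_eq_cons] at h4
    exact (List.nodup_cons.1 h4).1 hy2
  have heq : p = p1.append p2 := by
    exact (hT.existsUnique_path r x).unique hp hcat
  subst heq
  have key : ∀ i, T.dist r v ≤ i → (p1.append p2).getVert i = p2.getVert (i - T.dist r v) := by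
    intro i hi
    rw [Walk.getVert_append, hl, if_neg (by omega)]
  refine ⟨?_, ?_⟩
  · rw [key _ le_rfl]; simp
  · intro i hi
    rw [key i hi]
    exact hp2A _ (Walk.getVert_mem_support _ _)

lemma exists_top {ι : Type*} (T : SimpleGraph ι) (r : ι) (A : Set ι)
    (hA : (T.induce A).Connected) : ∃ v ∈ A, ∀ w ∈ A, T.dist r v ≤ T.dist r w := by
  obtain ⟨a⟩ := hA.nonempty
  have hne : A.Nonempty := ⟨a.1, a.2⟩
  refine ⟨Function.argminOn (T.dist r) A hne, Function.argminOn_mem _ _ _, ?_⟩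
  intro w hw
  exact Function.argminOn_le _ _ hw

lemma helly_ep {ι α : Type*} [Finite α] (T : SimpleGraph ι) (hT : T.IsTree)
    (f : α → Set ι) (k : ℕ) : ∀ (P : α → Prop)
    (_ : ∀ a, P a → (T.induce (f a)).Connected),
    (∃ J : Fin k → α, (∀ i, P (J i)) ∧ Pairwise fun i j => Disjoint (f (J i)) (f (J j))) ∨
    (∃ S : Finset ι, S.card + 1 ≤ k ∧ ∀ a, P a → ∃ s ∈ S, s ∈ f a) := by
  classical
  obtain ⟨r⟩ := hT.connected.nonempty
  induction k with
  | zero =>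
    intro P _
    left
    exact ⟨fun i => i.elim0, fun i => i.elim0, fun i => i.elim0⟩
  | succ k ih =>
    intro P hP
    by_cases hne : ∃ a, P a
    swap
    · right
      exact ⟨∅, by simp, fun a ha => (hne ⟨a, ha⟩).elim⟩
    have htop : ∀ a : {a // P a}, ∃ v ∈ f a.1, ∀ w ∈ f a.1, T.dist r v ≤ T.dist r w :=
      fun a => exists_top T r _ (hP a.1 a.2)
    choose top htm hmin using htop
    have : Nonempty {a // P a} := ⟨⟨hne.choose, hne.choose_spec⟩⟩
    obtain ⟨a, ha⟩ := Finite.exists_max (fun a : {a // P a} => T.dist r (top a))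
    have hkey : ∀ b, P b → top a ∉ f b → Disjoint (f a.1) (f b) := by
      intro b hb hnb
      rw [Set.disjoint_left]
      intro x hxa hxb
      obtain ⟨p, hp, _⟩ := hT.existsUnique_path r x
      have h1 := (top_path T hT r _ (hP _ a.2) _ (htm a) (hmin a) x hxa p hp).1
      have h2 := (top_path T hT r _ (hP _ hb) _ (htm ⟨b, hb⟩) (hmin ⟨b, hb⟩) x hxb p hp).2
        _ (ha ⟨b, hb⟩)
      rw [h1] at h2
      exact hnb h2
    rcases ih (fun b => P b ∧ top a ∉ f b) (fun b hb => hP b hb.1) with ⟨J, hJ, hd⟩ | ⟨S, hS, hh⟩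
    · left
      refine ⟨Fin.cons a.1 J, ?_, ?_⟩
      · intro i
        refine Fin.cases ?_ ?_ i
        · exact a.2
        · intro i; exact (hJ i).1
      · intro i j
        refine Fin.cases ?_ (fun i => ?_) i <;> refine Fin.cases ?_ (fun j => ?_) j
        · intro h; exact (h rfl).elim
        · intro _; exact hkey _ (hJ j).1 (hJ j).2
        · intro _; exact (hkey _ (hJ i).1 (hJ i).2).symm
        · intro h
          exact hd (fun e : i = j => h (by rw [e]))
    · right
      refine ⟨insert (top a) S, ?_, ?_⟩
      · have := Finset.card_insert_le (top a) S
        omega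
      · intro b hb
        by_cases hm : top a ∈ f b
        · exact ⟨_, Finset.mem_insert_self _ _, hm⟩
        · obtain ⟨s, hs, hs2⟩ := hh b ⟨hb, hm⟩
          exact ⟨s, Finset.mem_insert_of_mem hs, hs2⟩

/-- the trace of a vertex set in the decomposition tree -/
def trc {V ι : Type*} (X : Set V) (β : ι → Set X) (C : Set V) : Set ι :=
  {t | ∃ x : X, x.1 ∈ C ∧ x ∈ β t}

lemma common_bag {V ι : Type*} {G : SimpleGraph V} {X : Set V} {T : SimpleGraph ι}
    {β : ι → Set X} (h : IsTreeDecomp (torso G X) T β) (a b : X)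
    (p : G.Walk a.1 b.1) (hp : ∀ v ∈ p.support, v ∉ X ∨ v = a.1 ∨ v = b.1) :
    ∃ t, a ∈ β t ∧ b ∈ β t := by
  by_cases hab : a = b
  · subst hab
    obtain ⟨t, ht⟩ := h.covers_vertex a
    exact ⟨t, ht, ht⟩
  · apply h.covers_edge
    rw [torso, fromRel_adj]
    exact ⟨hab, Or.inl ⟨p, hp⟩⟩

lemma first_hit {V : Type*} {G : SimpleGraph V} {X C : Set V} {u y : C}
    (p : (G.induce C).Walk u y) (hy : y.1 ∈ X) :
    ∃ x : X, x.1 ∈ C ∧ ∃ r : G.Walk u.1 x.1, ∀ v ∈ r.support, v ∉ X ∨ v = x.1 := by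
  induction p with
  | nil =>
    rename_i u
    exact ⟨⟨u.1, hy⟩, u.2, Walk.nil, by simp⟩
  | cons hadj p ih =>
    rename_i u w y
    by_cases hu : u.1 ∈ X
    · exact ⟨⟨u.1, hu⟩, u.2, Walk.nil, by simp⟩
    · obtain ⟨x, hx, r, hr⟩ := ih hy
      refine ⟨x, hx, Walk.cons (by simpa using hadj) r, ?_⟩
      intro v hv
      rw [Walk.support_cons, List.mem_cons] at hv
      rcases hv with rfl | hv
      · exact Or.inl hu
      · exact hr v hv

lemma trc_inter {V ι : Type*} {G : SimpleGraph V} {X : Set V} {T : SimpleGraph ι}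
    {β : ι → Set X} (h : IsTreeDecomp (torso G X) T β) {C D : Set V}
    (hC : (G.induce C).Connected) (hD : (G.induce D).Connected)
    (hCX : ∃ x ∈ C, x ∈ X) (hDX : ∃ x ∈ D, x ∈ X)
    (hd : Disjoint (trc X β C) (trc X β D)) : Disjoint C D := by
  rw [Set.disjoint_left]
  intro v hvC hvD
  obtain ⟨x, hxC, hxX⟩ := hCX
  obtain ⟨y, hyD, hyX⟩ := hDX
  obtain ⟨p⟩ := hC.preconnected ⟨v, hvC⟩ ⟨x, hxC⟩
  obtain ⟨p'⟩ := hD.preconnected ⟨v, hvD⟩ ⟨y, hyD⟩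
  obtain ⟨a, haC, r, hr⟩ := first_hit p hxX
  obtain ⟨b, hbD, s, hs⟩ := first_hit p' hyX
  obtain ⟨t, ha, hb⟩ := common_bag h a b (r.reverse.append s) (by
    intro v hv
    rw [Walk.mem_support_append_iff, Walk.support_reverse, List.mem_reverse] at hv
    rcases hv with hv | hv
    · rcases hr v hv with h | h
      · exact Or.inl h
      · exact Or.inr (Or.inl h)
    · rcases hs v hv with h | h
      · exact Or.inl h
      · exact Or.inr (Or.inr h))
  exact Set.disjoint_left.1 hd ⟨a, haC, ha⟩ ⟨b, hbD, hb⟩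

/-- all nodes of the bags of `x` and `y` are linked inside the trace of `C` -/
def Lnk {V ι : Type*} (T : SimpleGraph ι) {X : Set V} (β : ι → Set X) (C : Set V)
    (x y : X) : Prop :=
  ∀ (s t : trc X β C), x ∈ β s.1 → y ∈ β t.1 → (T.induce (trc X β C)).Reachable s t

lemma lnk_self {V ι : Type*} {G : SimpleGraph V} {X : Set V} {T : SimpleGraph ι}
    {β : ι → Set X} (h : IsTreeDecomp (torso G X) T β) {C : Set V} (x : X) (hx : x.1 ∈ C) :
    Lnk T β C x x := by
  intro s t hs ht
  have h1 := (h.bags_connected x).preconnected ⟨s.1, hs⟩ ⟨t.1, ht⟩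
  exact h1.map (induceHomOfLE T (s := {t | x ∈ β t}) (s' := trc X β C)
    (fun t ht => ⟨x, hx, ht⟩)).toHom

lemma lnk_trans {V ι : Type*} {G : SimpleGraph V} {X : Set V} {T : SimpleGraph ι}
    {β : ι → Set X} (h : IsTreeDecomp (torso G X) T β) {C : Set V} {x y z : X} (hy : y.1 ∈ C)
    (h1 : Lnk T β C x y) (h2 : Lnk T β C y z) : Lnk T β C x z := by
  intro s t hs ht
  obtain ⟨u, hu⟩ := h.covers_vertex y
  exact (h1 s ⟨u, y, hy, hu⟩ hs hu).trans (h2 ⟨u, y, hy, hu⟩ t hu ht)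

lemma lnk_walk {V ι : Type*} {G : SimpleGraph V} {X : Set V} {T : SimpleGraph ι}
    {β : ι → Set X} (h : IsTreeDecomp (torso G X) T β) {C : Set V} {x y : X}
    (hx : x.1 ∈ C) (hy : y.1 ∈ C) (p : G.Walk x.1 y.1)
    (hp : ∀ v ∈ p.support, v ∉ X ∨ v = x.1 ∨ v = y.1) : Lnk T β C x y := by
  obtain ⟨u, hux, huy⟩ := common_bag h x y p hp
  intro s t hs ht
  exact (lnk_self h x hx s ⟨u, x, hx, hux⟩ hs hux).trans
    (lnk_self h y hy ⟨u, x, hx, hux⟩ t huy ht)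

lemma lnk_all {V ι : Type*} {G : SimpleGraph V} {X : Set V} {T : SimpleGraph ι}
    {β : ι → Set X} (h : IsTreeDecomp (torso G X) T β) {C : Set V} {u y : C}
    (p : (G.induce C).Walk u y) (hy : y.1 ∈ X) :
    ∀ (x : X) (_ : x.1 ∈ C) (r : G.Walk x.1 u.1)
      (_ : ∀ v ∈ r.support, v ∉ X ∨ v = x.1 ∨ v = u.1), Lnk T β C x ⟨y.1, hy⟩ := by
  induction p with
  | nil =>
    rename_i u
    intro x hx r hr
    exact lnk_walk h (y := ⟨u.1, hy⟩) hx u.2 r hr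
  | cons hadj p ih =>
    rename_i u w y
    intro x hx r hr
    have hadj' : G.Adj u.1 w.1 := by simpa using hadj
    by_cases hu : u.1 ∈ X
    · refine lnk_trans h (y := ⟨u.1, hu⟩) u.2
        (lnk_walk h (y := ⟨u.1, hu⟩) hx u.2 r hr) ?_
      refine ih hy ⟨u.1, hu⟩ u.2 (Walk.cons hadj' Walk.nil) ?_
      intro v hv
      simp at hv
      exact Or.inr hv
    · refine ih hy x hx (r.append (Walk.cons hadj' Walk.nil)) ?_
      intro v hv
      rw [Walk.mem_support_append_iff] at hv
      rcases hv with hv | hv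
      · rcases hr v hv with h | h | h
        · exact Or.inl h
        · exact Or.inr (Or.inl h)
        · exact Or.inl (h ▸ hu)
      · simp at hv
        rcases hv with h | h
        · exact Or.inl (h ▸ hu)
        · exact Or.inr (Or.inr h)

lemma trc_connected {V ι : Type*} {G : SimpleGraph V} {X : Set V} {T : SimpleGraph ι}
    {β : ι → Set X} (h : IsTreeDecomp (torso G X) T β) {C : Set V}
    (hC : (G.induce C).Connected) (hCX : ∃ x ∈ C, x ∈ X) :
    (T.induce (trc X β C)).Connected := by
  rw [connected_iff]
  constructor
  · intro s t
    obtain ⟨x, hxC, hx⟩ := s.2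
    obtain ⟨y, hyC, hy⟩ := t.2
    obtain ⟨p⟩ := hC.preconnected ⟨x.1, hxC⟩ ⟨y.1, hyC⟩
    exact lnk_all h p y.2 x hxC Walk.nil (by simp) s t hx hy
  · obtain ⟨x, hxC, hxX⟩ := hCX
    obtain ⟨t, ht⟩ := h.covers_vertex ⟨x, hxX⟩
    exact ⟨⟨t, ⟨x, hxX⟩, hxC, ht⟩⟩

lemma exists_comp {V : Type*} (G : SimpleGraph V) (X C : Set V)
    (hC : (G.induce C).Connected) (hCX : Disjoint C X) :
    ∃ D, C ⊆ D ∧ IsComponentAvoiding G X D := by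
  obtain ⟨c⟩ := hC.nonempty
  have hsub : C ⊆ Xᶜ := fun x hx hxX => Set.disjoint_left.1 hCX hx hxX
  let K := (G.induce Xᶜ).connectedComponentMk ⟨c.1, hsub c.2⟩
  refine ⟨Subtype.val '' K.supp, ?_, ?_, ?_, ?_⟩
  · intro x hx
    refine ⟨⟨x, hsub hx⟩, ?_, rfl⟩
    rw [ConnectedComponent.mem_supp_iff, ConnectedComponent.eq]
    exact (hC.preconnected ⟨x, hx⟩ c).map (induceHomOfLE G hsub).toHom
  · rw [Set.disjoint_left]
    rintro _ ⟨x, _, rfl⟩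
    exact x.2
  · have h1 : ((G.induce Xᶜ).induce K.supp).Connected := K.connected_toSimpleGraph
    let φ : (G.induce Xᶜ).induce K.supp →g G.induce (Subtype.val '' K.supp) :=
      { toFun := fun x => ⟨x.1.1, x.1, x.2, rfl⟩
        map_rel' := by intro a b hab; simpa using hab }
    refine h1.map φ ?_
    rintro ⟨_, x, hx, rfl⟩
    exact ⟨⟨x, hx⟩, rfl⟩
  · rintro _ ⟨x, hx, rfl⟩ y hy hadj
    refine ⟨⟨y, hy⟩, ?_, rfl⟩
    rw [ConnectedComponent.mem_supp_iff] at hx ⊢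
    rw [← hx, ConnectedComponent.eq]
    exact Adj.reachable (by simpa using hadj.symm)

/-- The classic covering/packing scheme on graphs whose torso of `X` has bounded
treewidth while all components of `G − X` are restricted. -/
theorem classic_scheme (q t k : ℕ)
    {m n : ℕ} (H : SimpleGraph (Fin m)) (ψ : Fin m → Finset (Fin q))
    (G : SimpleGraph (Fin n)) (χ : Fin n → Finset (Fin q))
    (X : Set (Fin n))
    (hcomp : ∀ C : Set (Fin n), IsComponentAvoiding G X C →
      ∃ c : Fin q, ∀ x ∈ C, c ∉ χ x)
    (htw : TreewidthAtMost (torso G X) t) :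
    (∃ S : Set (Fin n), S.ncard ≤ (t + 1) * (k - 1) ∧
      ∀ C : Set (Fin n), IsComponentAvoiding G S C →
        ¬ IsColorfulMinor H ψ (G.induce C) (fun x => χ x.1)) ∨
    (1 ≤ q ∧ (Finset.univ.biUnion ψ).card ≤ q - 1 ∧
      ∃ S : Set (Fin n), S.ncard ≤ (t + 1) * (k - 1) ∧
      ∀ C : Set (Fin n), IsComponentAvoiding G S C →
        (∃ c : Fin q, ∀ x ∈ C, c ∉ χ x) ∨
        ¬ IsColorfulMinor H ψ (G.induce C) (fun x => χ x.1)) ∨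
    (∃ J : Fin k → Set (Fin n),
      (Pairwise fun i j => Disjoint (J i) (J j)) ∧
      ∀ i, IsColorfulMinor H ψ (G.induce (J i)) (fun x => χ x.1)) := by
  classical
  obtain ⟨M, T, β, hTD, hw⟩ := htw
  let P : Set (Fin n) → Prop := fun C => (G.induce C).Connected ∧
    (¬ ∃ c : Fin q, ∀ x ∈ C, c ∉ χ x) ∧ IsColorfulMinor H ψ (G.induce C) (fun x => χ x.1)
  have hPX : ∀ C, P C → ∃ x ∈ C, x ∈ X := by
    intro C hC
    by_contra hno
    have hdis : Disjoint C X := Set.disjoint_left.2 fun x h1 h2 => hno ⟨x, h1, h2⟩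
    obtain ⟨D, hCD, hD⟩ := exists_comp G X C hC.1 hdis
    obtain ⟨c, hc⟩ := hcomp D hD
    exact hC.2.1 ⟨c, fun x hx => hc x (hCD hx)⟩
  rcases helly_ep T hTD.isTree (trc X β) k P
    (fun C hC => trc_connected hTD hC.1 (hPX C hC)) with ⟨J, hJ, hd⟩ | ⟨S, hS, hh⟩
  · right; right
    exact ⟨J, fun i j hij => trc_inter hTD (hJ i).1 (hJ j).1 (hPX _ (hJ i)) (hPX _ (hJ j)) (hd hij),
      fun i => (hJ i).2.2⟩
  · have main : ∃ S : Set (Fin n), S.ncard ≤ (t + 1) * (k - 1) ∧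
        ∀ C : Set (Fin n), IsComponentAvoiding G S C →
        (∃ c : Fin q, ∀ x ∈ C, c ∉ χ x) ∨
        ¬ IsColorfulMinor H ψ (G.induce C) (fun x => χ x.1) := by
      refine ⟨⋃ s ∈ S, Subtype.val '' β s, ?_, ?_⟩
      · have h1 : (⋃ s ∈ S, Subtype.val '' β s).ncard ≤ ∑ s ∈ S, (Subtype.val '' β s).ncard :=
          Finset.set_ncard_biUnion_le _ _
        have h2 : ∑ s ∈ S, (Subtype.val '' β s).ncard ≤ S.card • (t + 1) :=
          Finset.sum_le_card_nsmul _ _ _ fun s _ =>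
            (Set.ncard_image_le (Set.toFinite _)).trans (hw s)
        rw [smul_eq_mul, mul_comm] at h2
        exact (h1.trans h2).trans (Nat.mul_le_mul_left _ (by omega))
      · intro C hC
        by_contra hcon
        rw [not_or, not_not] at hcon
        obtain ⟨s, hs, x, hxC, hx⟩ := hh C ⟨hC.2.1, hcon.1, hcon.2⟩
        refine Set.disjoint_left.1 hC.1 hxC ?_
        simp only [Set.mem_iUnion]
        exact ⟨s, hs, x, hx, rfl⟩
    by_cases hq : 1 ≤ q ∧ (Finset.univ.biUnion ψ).card ≤ q - 1
    · right; left
      exact ⟨hq.1, hq.2, main⟩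
    · left
      obtain ⟨S', hS', hC'⟩ := main
      refine ⟨S', hS', fun C hC => ?_⟩
      rcases hC' C hC with ⟨c, hc⟩ | h
      · rintro ⟨B, _, _, _, hB⟩
        have hcard : (Finset.univ.biUnion ψ).card = Fintype.card (Fin q) := by
          have := Finset.card_le_univ (Finset.univ.biUnion ψ)
          rw [Fintype.card_fin] at this ⊢
          have := c.pos
          by_contra hne
          exact hq ⟨by omega, by omega⟩
        have huniv := (Finset.card_eq_iff_eq_univ _).1 hcard
        have hcm : c ∈ Finset.univ.biUnion ψ := huniv ▸ Finset.mem_univ c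
        obtain ⟨v, _, hv⟩ := Finset.mem_biUnion.1 hcm
        obtain ⟨x, _, hx⟩ := hB v c hv
        exact hc x.1 x.2 hx
      · exact h
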